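/- Let (X, Z) be a pair of jointly distributed random variables with values in finite alphabets 𝒳 × 𝒵, let (X^n, Z^n) be n i.i.d. copies of (X, Z), and let C be a random binning codebook on 𝒳^n at rates (R_𝒳, R_P), independent of (X^n, Z^n). If R_𝒳 ≥ 0, R_P ≥ 0 and R_𝒳 + R_P ≤ H(X|Z) − 2δ for some δ > 0, then limsup_{n→∞} (1/n)·H(X^n | Z^n, g(X^n), ψ(X^n), C) ≤ H(X|Z) − R_𝒳 − R_P + δ. -/

import Mathlib

open Filter

/-- A probability distribution on a finite sample space `Ω`, given by nonnegative weights
summing to one. -/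
structure FinProb (Ω : Type*) [Fintype Ω] where
  w : Ω → ℝ
  nonneg : ∀ ω, 0 ≤ w ω
  sum_one : ∑ ω, w ω = 1

open scoped Classical in
/-- The distribution (probability mass function) of a random variable `X : Ω → S`. -/
noncomputable def FinProb.dist {Ω : Type*} [Fintype Ω] (P : FinProb Ω)
    {S : Type*} (X : Ω → S) (s : S) : ℝ :=
  ∑ ω ∈ Finset.univ.filter (fun ω => X ω = s), P.w ω

/-- Shannon entropy (base-2 logarithm) of a random variable `X : Ω → S`. -/
noncomputable def FinProb.H {Ω : Type*} [Fintype Ω] (P : FinProb Ω)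
    {S : Type*} [Fintype S] (X : Ω → S) : ℝ :=
  - ∑ s, P.dist X s * Real.logb 2 (P.dist X s)

/-- Conditional Shannon entropy H(X|Y) (base-2 logarithm). -/
noncomputable def FinProb.condH {Ω : Type*} [Fintype Ω] (P : FinProb Ω)
    {S T : Type*} [Fintype S] [Fintype T]
    (X : Ω → S) (Y : Ω → T) : ℝ :=
  P.H (fun ω => (X ω, Y ω)) - P.H Y

/-- Shannon entropy (base-2 logarithm) of a probability mass function `p` on a finite
alphabet. -/
noncomputable def pmfEntropy {S : Type*} [Fintype S] (p : S → ℝ) : ℝ :=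
  - ∑ s, p s * Real.logb 2 (p s)

/-- `⌈2^(n·R)⌉`, the number of labels used by a random binning codebook of rate `R` at
blocklength `n`. -/
noncomputable def nLabels (R : ℝ) (n : ℕ) : ℕ := ⌈(2 : ℝ) ^ ((n : ℝ) * R)⌉₊

instance (R : ℝ) (n : ℕ) : NeZero (nLabels R n) :=
  ⟨Nat.pos_iff_ne_zero.mp (Nat.ceil_pos.mpr (by positivity))⟩

instance (R : ℝ) (n : ℕ) : Nonempty (Fin (nLabels R n)) :=
  ⟨⟨0, Nat.pos_of_ne_zero (NeZero.ne _)⟩⟩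

/-- The sum over all sequences of the product of i.i.d. letter probabilities is one. -/
theorem iid_sum_one {𝒵 : Type*} [Fintype 𝒵] {p : 𝒵 → ℝ}
    (hp1 : ∑ z, p z = 1) (n : ℕ) :
    ∑ z : Fin n → 𝒵, ∏ i, p (z i) = 1 := by
  classical
  have h := Finset.prod_univ_sum (fun _ : Fin n => (Finset.univ : Finset 𝒵))
    (fun _ z => p z)
  rw [Fintype.piFinset_univ] at h
  rw [← h]
  simp [hp1]

/-- The joint distribution of an i.i.d.-style source with pmf `q` on the finite set `S`,
together with an independent uniformly distributed random codebook `C`: every label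
assignment (element of the finite function space `C`) is equally likely, which is the same
as saying that all the labels are mutually independent and uniformly distributed, and
independent of the source. -/
noncomputable def srcCbProb {S C : Type*} [Fintype S] [Fintype C] [Nonempty C]
    (q : S → ℝ) (h0 : ∀ s, 0 ≤ q s) (h1 : ∑ s, q s = 1) : FinProb (S × C) where
  w := fun sc => q sc.1 * ((Fintype.card C : ℝ))⁻¹
  nonneg := fun sc => mul_nonneg (h0 _) (by positivity)
  sum_one := by
    have hC : (Fintype.card C : ℝ) ≠ 0 := by
      exact_mod_cast Fintype.card_ne_zero
    have hs : ∀ s : S, ∑ _c : C, q s * ((Fintype.card C : ℝ))⁻¹ = q s := by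
      intro s
      rw [Finset.sum_const, Finset.card_univ, nsmul_eq_mul]
      field_simp
    rw [Fintype.sum_prod_type]
    simp_rw [hs]
    exact h1

/-- Entropy as an expectation over the sample space. -/
theorem FinProb.H_eq {Ω : Type*} [Fintype Ω] (P : FinProb Ω)
    {S : Type*} [Fintype S] (X : Ω → S) :
    P.H X = - ∑ ω, P.w ω * Real.logb 2 (P.dist X (X ω)) := by
  classical
  unfold FinProb.H
  congr 1
  rw [← Finset.sum_fiberwise Finset.univ X]
  refine Finset.sum_congr rfl fun s _ => ?_
  conv_lhs => rw [FinProb.dist, Finset.sum_mul]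
  refine Finset.sum_congr (by ext; simp) fun ω hω => ?_
  simp only [Finset.mem_filter] at hω
  rw [hω.2]
  rfl

theorem FinProb.condH_eq {Ω : Type*} [Fintype Ω] (P : FinProb Ω)
    {S T : Type*} [Fintype S] [Fintype T] (X : Ω → S) (Y : Ω → T) :
    P.condH X Y = ∑ ω, P.w ω * (Real.logb 2 (P.dist Y (Y ω))
      - Real.logb 2 (P.dist (fun ω => (X ω, Y ω)) (X ω, Y ω))) := by
  unfold FinProb.condH
  rw [P.H_eq, P.H_eq]
  simp only [mul_sub, Finset.sum_sub_distrib]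
  ring

theorem FinProb.dist_inj {Ω : Type*} [Fintype Ω] (P : FinProb Ω)
    {S : Type*} (X : Ω → S) (hX : Function.Injective X) (ω : Ω) :
    P.dist X (X ω) = P.w ω := by
  classical
  unfold FinProb.dist
  rw [Finset.sum_eq_single ω]
  · intro b hb hne
    simp only [Finset.mem_filter] at hb
    exact absurd (hX hb.2) hne
  · simp

theorem card_collide {α L : Type*} [Fintype α] [DecidableEq α] [Fintype L] [DecidableEq L]
    (a b : α) (hab : a ≠ b) :
    (Finset.univ.filter (fun c : α → L => c a = c b)).card * Fintype.card L
      ≤ Fintype.card (α → L) := by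
  rw [← Finset.card_univ (α := L), ← Finset.card_product, ← Finset.card_univ (α := α → L)]
  refine Finset.card_le_card_of_injOn (fun cl => Function.update cl.1 b cl.2) (by simp) ?_
  rintro ⟨c, l⟩ h ⟨c', l'⟩ h' heq
  simp only [Finset.coe_product, Finset.coe_filter, Set.mem_prod, Set.mem_ofPred_eq,
    Finset.mem_univ, true_and, Finset.coe_univ, Set.mem_univ, and_true] at h h'
  simp only at heq
  have hl : l = l' := by simpa using congrFun heq b
  have hne : ∀ x, x ≠ b → c x = c' x := fun x hx => by
    simpa [Function.update_of_ne hx] using congrFun heq x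
  refine Prod.ext (funext fun x => ?_) hl
  by_cases hx : x = b
  · subst hx
    simp only
    rw [← h, ← h', hne a hab]
  · exact hne x hx

open scoped Classical in
theorem condH_le {V α ζ L : Type*} [Fintype V] [Fintype α] [DecidableEq α] [Fintype ζ]
    [Fintype L] [Nonempty L] (fx : V → α) (fz : V → ζ)
    (hinj : ∀ v v', fx v = fx v' → fz v = fz v' → v = v')
    (P : V → ℝ) (h0 : ∀ v, 0 ≤ P v) (h1 : ∑ v, P v = 1) :
    (srcCbProb (C := α → L) P h0 h1).condH (fun ω => fx ω.1)
      (fun ω => (fz ω.1, ω.2 (fx ω.1), ω.2))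
    ≤ ∑ v, P v * Real.logb 2
        (1 + (∑ v' ∈ Finset.univ.filter (fun v' => fz v' = fz v), P v')
          / (P v * Fintype.card L)) := by
  set N : ℝ := (Fintype.card (α → L) : ℝ) with hN
  have hNpos : 0 < N := by
    rw [hN]; exact_mod_cast Fintype.card_pos
  have hMpos : (0:ℝ) < Fintype.card L := by exact_mod_cast Fintype.card_pos
  rw [FinProb.condH_eq, Fintype.sum_prod_type]
  refine Finset.sum_le_sum fun v _ => ?_
  rcases (h0 v).eq_or_lt with hv | hv
  · simp [srcCbProb, ← hv]
  set A : (α → L) → ℝ := fun c => ∑ v' ∈ Finset.univ.filter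
    (fun v' => fz v' = fz v ∧ c (fx v') = c (fx v)), P v' with hA
  have hApos : ∀ c, 0 < A c := fun c => by
    refine lt_of_lt_of_le hv ?_
    exact Finset.single_le_sum (f := P) (fun i _ => h0 i) (by simp)
  have hdist : ∀ c, (srcCbProb (C := α → L) P h0 h1).dist
      (fun ω => (fz ω.1, ω.2 (fx ω.1), ω.2)) (fz v, c (fx v), c) = A c * N⁻¹ := by
    intro c
    unfold FinProb.dist
    rw [hA]
    simp only
    rw [Finset.sum_mul, Finset.sum_filter, Fintype.sum_prod_type, Finset.sum_filter]
    refine Finset.sum_congr rfl fun v' _ => ?_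
    rw [Finset.sum_eq_single c]
    · simp [srcCbProb, hN]
    · intro b _ hb
      rw [if_neg]
      intro h
      exact hb (by simpa using congrArg (fun t => t.2.2) h)
    · simp
  have hdist2 : ∀ c, (srcCbProb (C := α → L) P h0 h1).dist
      (fun ω => (fx ω.1, (fz ω.1, ω.2 (fx ω.1), ω.2))) (fx v, (fz v, c (fx v), c))
        = P v * N⁻¹ := by
    intro c
    refine FinProb.dist_inj _ (fun ω : V × (α → L) =>
      (fx ω.1, (fz ω.1, ω.2 (fx ω.1), ω.2))) ?_ (v, c)
    rintro ⟨a, b⟩ ⟨a', b'⟩ h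
    simp only [Prod.mk.injEq] at h
    exact Prod.ext (hinj _ _ h.1 h.2.1) h.2.2.2
  have hterm : ∀ c, Real.logb 2 (A c * N⁻¹) - Real.logb 2 (P v * N⁻¹)
      = Real.logb 2 (A c / P v) := by
    intro c
    have := hApos c
    rw [← Real.logb_div (by positivity) (by positivity)]
    congr 1
    field_simp
  simp only [hdist, hdist2, hterm]
  have hw : ∀ c : α → L, (srcCbProb (C := α → L) P h0 h1).w (v, c) = P v * N⁻¹ := fun c => rfl
  simp only [hw, mul_assoc]
  rw [← Finset.mul_sum]
  refine mul_le_mul_of_nonneg_left ?_ hv.le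
  -- Jensen
  have hconc : ConcaveOn ℝ (Set.Ioi 0) (Real.logb 2) := by
    have := strictConcaveOn_log_Ioi.concaveOn.smul (c := (Real.log 2)⁻¹)
      (by have := Real.log_pos one_lt_two; positivity)
    refine this.congr fun x _ => ?_
    simp [Real.logb, div_eq_inv_mul]
  have hJ := hconc.le_map_sum (t := (Finset.univ : Finset (α → L))) (w := fun _ => N⁻¹)
    (p := fun c => A c / P v) (fun _ _ => by positivity)
    (by simp only [Finset.sum_const, Finset.card_univ, nsmul_eq_mul, ← hN]; field_simp)
    (fun c _ => div_pos (hApos c) hv)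
  simp only [smul_eq_mul] at hJ
  refine hJ.trans ?_
  refine Real.logb_le_logb_of_le one_lt_two ?_ ?_
  · refine Finset.sum_pos (fun c _ => ?_) Finset.univ_nonempty
    have := hApos c
    positivity
  -- average of A
  have hcol : ∀ v', fz v' = fz v → v' ≠ v →
      ((Finset.univ.filter (fun c : α → L => c (fx v') = c (fx v))).card : ℝ)
        ≤ N / Fintype.card L := by
    intro v' hz hne
    have := card_collide (L := L) (fx v') (fx v) (fun h => hne (hinj _ _ h hz))
    rw [le_div_iff₀ hMpos, hN]
    exact_mod_cast this
  have hsum : ∑ c, A c ≤ N * P v + N / Fintype.card L *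
      ∑ v' ∈ Finset.univ.filter (fun v' => fz v' = fz v), P v' := by
    have e1 : ∑ c, A c = ∑ v' ∈ Finset.univ.filter (fun v' => fz v' = fz v),
        ((Finset.univ.filter (fun c : α → L => c (fx v') = c (fx v))).card : ℝ) * P v' := by
      simp only [hA]
      simp_rw [← Finset.filter_filter]
      simp_rw [Finset.sum_filter _ (s := Finset.univ.filter (fun v' => fz v' = fz v))]
      rw [Finset.sum_comm]
      refine Finset.sum_congr rfl fun v' _ => ?_
      rw [← Finset.sum_filter, Finset.sum_const, nsmul_eq_mul]
    rw [e1, Finset.mul_sum]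
    have hvm : v ∈ Finset.univ.filter (fun v' => fz v' = fz v) := by simp
    rw [← Finset.add_sum_erase _ _ hvm, ← Finset.add_sum_erase _ (fun i => N / _ * P i) hvm]
    have e2 : ((Finset.univ.filter (fun c : α → L => c (fx v) = c (fx v))).card : ℝ) = N := by
      simp [hN]
    rw [e2]
    have e3 : 0 ≤ N / (Fintype.card L : ℝ) * P v := by positivity
    have e4 := Finset.sum_le_sum (s := (Finset.univ.filter (fun v' => fz v' = fz v)).erase v)
      (f := fun v' => ((Finset.univ.filter (fun c : α → L => c (fx v') = c (fx v))).card : ℝ)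
        * P v') (g := fun i => N / (Fintype.card L : ℝ) * P i) (fun i hi => by
        simp only [Finset.mem_erase, Finset.mem_filter] at hi
        exact mul_le_mul_of_nonneg_right (hcol i hi.2.2 hi.1) (h0 i))
    linarith
  calc ∑ c, N⁻¹ * (A c / P v) = N⁻¹ / P v * ∑ c, A c := by
        rw [Finset.mul_sum]
        exact Finset.sum_congr rfl fun c _ => by ring
    _ ≤ N⁻¹ / P v * (N * P v + N / Fintype.card L *
      ∑ v' ∈ Finset.univ.filter (fun v' => fz v' = fz v), P v') := by gcongr
    _ = _ := by field_simp

/-- First and second moments of an i.i.d. sum. -/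
theorem iid_moments {V : Type*} [Fintype V] (p f : V → ℝ) (hp1 : ∑ v, p v = 1)
    (hf : ∑ v, p v * f v = 0) (n : ℕ) :
    ∑ v : Fin n → V, (∏ i, p (v i)) * (∑ i, f (v i)) = 0 ∧
    ∑ v : Fin n → V, (∏ i, p (v i)) * (∑ i, f (v i)) ^ 2 = n * ∑ v, p v * f v ^ 2 := by
  induction n with
  | zero => simp
  | succ n ih =>
    have h1 := iid_sum_one hp1 n
    obtain ⟨ih1, ih2⟩ := ih
    have key : ∀ F : (Fin (n+1) → V) → ℝ, ∑ v, F v = ∑ a : V, ∑ v : Fin n → V, F (Fin.cons a v) := by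
      intro F
      rw [← (Fin.consEquiv (fun _ : Fin (n+1) => V)).sum_comp, Fintype.sum_prod_type]
      rfl
    rw [key, key]
    simp only [Fin.prod_univ_succ, Fin.sum_univ_succ, Fin.cons_zero, Fin.cons_succ]
    constructor
    · have : ∀ a : V, ∑ v : Fin n → V, p a * (∏ i, p (v i)) * (f a + ∑ i, f (v i)) = p a * f a := by
        intro a
        calc _ = p a * f a * ∑ v : Fin n → V, (∏ i, p (v i)) +
              p a * ∑ v : Fin n → V, (∏ i, p (v i)) * (∑ i, f (v i)) := by
              rw [Finset.mul_sum, Finset.mul_sum, ← Finset.sum_add_distrib]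
              exact Finset.sum_congr rfl fun v _ => by ring
          _ = _ := by rw [h1, ih1]; ring
      simp only [this, hf]
    · have : ∀ a : V, ∑ v : Fin n → V, p a * (∏ i, p (v i)) * (f a + ∑ i, f (v i)) ^ 2
          = p a * f a ^ 2 + p a * (n * ∑ v, p v * f v ^ 2) := by
        intro a
        calc _ = p a * f a ^ 2 * ∑ v : Fin n → V, (∏ i, p (v i)) +
              2 * p a * f a * ∑ v : Fin n → V, (∏ i, p (v i)) * (∑ i, f (v i)) +
              p a * ∑ v : Fin n → V, (∏ i, p (v i)) * (∑ i, f (v i)) ^ 2 := by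
              rw [Finset.mul_sum, Finset.mul_sum, Finset.mul_sum, ← Finset.sum_add_distrib,
                ← Finset.sum_add_distrib]
              exact Finset.sum_congr rfl fun v _ => by ring
          _ = _ := by rw [h1, ih1, ih2]; ring
      simp only [this, Finset.sum_add_distrib, ← Finset.sum_mul, hp1]
      push_cast
      ring

open scoped Classical in
theorem marg_prod {𝒳 𝒵 : Type*} [Fintype 𝒳] [Fintype 𝒵] (p : 𝒳 × 𝒵 → ℝ) (n : ℕ)
    (z : Fin n → 𝒵) :
    ∑ v' ∈ Finset.univ.filter (fun v' : Fin n → 𝒳 × 𝒵 => (fun i => (v' i).2) = z), ∏ i, p (v' i)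
      = ∏ i, ∑ v ∈ Finset.univ.filter (fun v : 𝒳 × 𝒵 => v.2 = z i), p v := by
  rw [Finset.prod_univ_sum]
  refine Finset.sum_congr ?_ fun _ _ => rfl
  ext v
  simp [Fintype.mem_piFinset, funext_iff]

/-- Pointwise bound. -/
theorem log_bound (S a b d M : ℝ) (hd : 0 < d) (hab : a ≤ b - 2 * d)
    (hM : (2:ℝ) ^ a ≤ M) :
    Real.logb 2 (1 + (2:ℝ) ^ S / M) ≤ 1 + (S - a) + (S - b) ^ 2 / (8 * d) := by
  have h2a : (0:ℝ) < 2 ^ a := by positivity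
  have hM0 : 0 < M := h2a.trans_le hM
  have hS : (0:ℝ) < 2 ^ S := by positivity
  have hsq : b - S - 2 * d ≤ (S - b) ^ 2 / (8 * d) := by
    rw [le_div_iff₀ (by positivity)]
    nlinarith [sq_nonneg (S - b + 4 * d)]
  have hsq0 : 0 ≤ (S - b) ^ 2 / (8 * d) := by positivity
  have h1 : 1 + (2:ℝ) ^ S / M ≤ 2 ^ (1 + max 0 (S - a)) := by
    have e1 : (2:ℝ) ^ S / M ≤ 2 ^ (max 0 (S - a)) := by
      calc (2:ℝ) ^ S / M ≤ 2 ^ S / 2 ^ a := by gcongr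
        _ = 2 ^ (S - a) := (Real.rpow_sub two_pos _ _).symm
        _ ≤ _ := Real.rpow_le_rpow_of_exponent_le one_le_two (le_max_right _ _)
    have e2 : (1:ℝ) ≤ 2 ^ (max 0 (S - a)) :=
      Real.one_le_rpow one_le_two (le_max_left _ _)
    rw [Real.rpow_add two_pos, Real.rpow_one]
    linarith
  have h2 : Real.logb 2 (1 + (2:ℝ) ^ S / M) ≤ 1 + max 0 (S - a) := by
    calc _ ≤ Real.logb 2 ((2:ℝ) ^ (1 + max 0 (S - a))) :=
          Real.logb_le_logb_of_le one_lt_two (by positivity) h1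
      _ = _ := Real.logb_rpow two_pos (by norm_num)
  refine h2.trans ?_
  rcases max_cases 0 (S - a) with ⟨h, _⟩ | ⟨h, _⟩ <;> rw [h] <;> linarith

/-- Let `(X, Z)` have joint pmf `p` on the finite alphabet `𝒳 × 𝒵`, let
`(X^n, Z^n)` be `n` i.i.d. copies of `(X, Z)`, and let `C` be a random binning codebook on
`𝒳^n` at rates `(R_𝒳, R_P)` (i.e. `C` assigns to each `x ∈ 𝒳^n` a pair of labels
`(g(x), ψ(x)) ∈ {1,…,⌈2^{nR_𝒳}⌉} × {1,…,⌈2^{nR_P}⌉}`, all labels mutually independent and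
uniform), independent of `(X^n, Z^n)`. If `R_𝒳 ≥ 0`, `R_P ≥ 0` and
`R_𝒳 + R_P ≤ H(X|Z) − 2δ` for some `δ > 0`, then
`limsup_{n→∞} (1/n)·H(X^n | Z^n, g(X^n), ψ(X^n), C) ≤ H(X|Z) − R_𝒳 − R_P + δ`. -/
theorem statement1 {𝒳 𝒵 : Type*} [Fintype 𝒳] [DecidableEq 𝒳] [Fintype 𝒵] [DecidableEq 𝒵]
    (p : 𝒳 × 𝒵 → ℝ) (hp0 : ∀ v, 0 ≤ p v) (hp1 : ∑ v, p v = 1)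
    (R_X R_P δ : ℝ) (hRX : 0 ≤ R_X) (hRP : 0 ≤ R_P) (hδ : 0 < δ)
    (hrate : R_X + R_P ≤
      (FinProb.mk p hp0 hp1).condH (fun v => v.1) (fun v => v.2) - 2 * δ) :
    Filter.limsup (fun n : ℕ =>
        (1 / (n : ℝ)) *
          (srcCbProb (fun v : Fin n → 𝒳 × 𝒵 => ∏ i, p (v i))
              (fun v => Finset.prod_nonneg fun i _ => hp0 (v i))
              (iid_sum_one hp1 n)).condH
            (fun ω => fun i => (ω.1 i).1)
            (fun ω : (Fin n → 𝒳 × 𝒵) ×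
                ((Fin n → 𝒳) → Fin (nLabels R_X n) × Fin (nLabels R_P n)) =>
              ((fun i => (ω.1 i).2), ω.2 (fun i => (ω.1 i).1), ω.2)))
      Filter.atTop
    ≤ (FinProb.mk p hp0 hp1).condH (fun v => v.1) (fun v => v.2) - R_X - R_P + δ := by
  classical
  set Hc := (FinProb.mk p hp0 hp1).condH (fun v => v.1) (fun v => v.2) with hHc
  set q : 𝒵 → ℝ := fun z => ∑ v ∈ Finset.univ.filter (fun v : 𝒳 × 𝒵 => v.2 = z), p v with hq
  have hqpos : ∀ v, 0 < p v → 0 < q v.2 := fun v hv =>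
    lt_of_lt_of_le hv (Finset.single_le_sum (f := p) (fun i _ => hp0 i) (by simp))
  set Y : 𝒳 × 𝒵 → ℝ := fun v => Real.logb 2 (q v.2) - Real.logb 2 (p v) with hY
  have hHY : Hc = ∑ v, p v * Y v := by
    rw [hHc, FinProb.condH_eq]
    refine Finset.sum_congr rfl fun v _ => ?_
    rw [FinProb.dist_inj _ (fun v : 𝒳 × 𝒵 => (v.1, v.2)) (fun a b h => h) v]
    simp only [hY, hq, FinProb.dist]
  have hf0 : ∑ v, p v * (Y v - Hc) = 0 := by
    simp only [mul_sub, Finset.sum_sub_distrib, ← Finset.sum_mul, hp1, ← hHY]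
    ring
  set σ := ∑ v, p v * (Y v - Hc) ^ 2 with hσ
  have hσ0 : 0 ≤ σ := Finset.sum_nonneg fun v _ => mul_nonneg (hp0 v) (sq_nonneg _)
  set K := 1 + σ / (8 * δ) with hK
  have hbound : ∀ n : ℕ, 0 < n →
          (srcCbProb (fun v : Fin n → 𝒳 × 𝒵 => ∏ i, p (v i))
              (fun v => Finset.prod_nonneg fun i _ => hp0 (v i))
              (iid_sum_one hp1 n)).condH
            (fun ω => fun i => (ω.1 i).1)
            (fun ω : (Fin n → 𝒳 × 𝒵) ×
                ((Fin n → 𝒳) → Fin (nLabels R_X n) × Fin (nLabels R_P n)) =>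
              ((fun i => (ω.1 i).2), ω.2 (fun i => (ω.1 i).1), ω.2))
          ≤ n * (Hc - R_X - R_P) + K := by
    intro n hn
    have hn' : (0:ℝ) < n := by exact_mod_cast hn
    refine (condH_le (L := Fin (nLabels R_X n) × Fin (nLabels R_P n))
      (fun v : Fin n → 𝒳 × 𝒵 => fun i => (v i).1)
      (fun v : Fin n → 𝒳 × 𝒵 => fun i => (v i).2)
      (fun v v' h h' => funext fun i => Prod.ext (congrFun h i) (congrFun h' i))
      (fun v => ∏ i, p (v i)) (fun v => Finset.prod_nonneg fun i _ => hp0 (v i))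
      (iid_sum_one hp1 n)).trans ?_
    obtain ⟨m1, m2⟩ := iid_moments p (fun v => Y v - Hc) hp1 hf0 n
    have hM : (2:ℝ) ^ (n * (R_X + R_P)) ≤
        (Fintype.card (Fin (nLabels R_X n) × Fin (nLabels R_P n)) : ℝ) := by
      simp only [Fintype.card_prod, Fintype.card_fin, Nat.cast_mul]
      rw [mul_add, Real.rpow_add two_pos]
      exact mul_le_mul (Nat.le_ceil _) (Nat.le_ceil _) (by positivity) (by positivity)
    have step : ∀ v : Fin n → 𝒳 × 𝒵, (∏ i, p (v i)) * Real.logb 2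
        (1 + (∑ v' ∈ Finset.univ.filter (fun v' : Fin n → 𝒳 × 𝒵 =>
          (fun i => (v' i).2) = (fun i => (v i).2)), ∏ i, p (v' i))
          / ((∏ i, p (v i)) * (Fintype.card (Fin (nLabels R_X n) × Fin (nLabels R_P n)) : ℝ)))
        ≤ (∏ i, p (v i)) * (1 + n * (Hc - R_X - R_P))
          + (∏ i, p (v i)) * (∑ i, (Y (v i) - Hc))
          + (8 * (n * δ))⁻¹ * ((∏ i, p (v i)) * (∑ i, (Y (v i) - Hc)) ^ 2) := by
      intro v
      rcases (Finset.prod_nonneg fun i (_ : i ∈ Finset.univ) => hp0 (v i)).eq_or_lt with h | h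
      · simp [← h]
      have hpv : ∀ i, 0 < p (v i) := fun i => (hp0 _).lt_of_ne' fun h0 =>
        h.ne' (Finset.prod_eq_zero (Finset.mem_univ i) h0)
      have hS : (2:ℝ) ^ (∑ i, Y (v i)) = (∏ i, q (v i).2) / ∏ i, p (v i) := by
        rw [Real.rpow_sum_of_pos two_pos, ← Finset.prod_div_distrib]
        refine Finset.prod_congr rfl fun i _ => ?_
        rw [hY]
        simp only
        rw [Real.rpow_sub two_pos, Real.rpow_logb two_pos (by norm_num) (hqpos _ (hpv i)),
          Real.rpow_logb two_pos (by norm_num) (hpv i)]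
      have hsum : ∑ i, (Y (v i) - Hc) = ∑ i, Y (v i) - n * Hc := by
        simp [Finset.sum_sub_distrib]
      have hb := log_bound (∑ i, Y (v i)) (n * (R_X + R_P)) (n * Hc) (n * δ) _
        (by positivity) (by nlinarith) hM
      have hmarg : (∑ v' ∈ Finset.univ.filter (fun v' : Fin n → 𝒳 × 𝒵 =>
          (fun i => (v' i).2) = (fun i => (v i).2)), ∏ i, p (v' i)) = ∏ i, q (v i).2 := by
        convert marg_prod p n (fun i => (v i).2) using 1
        · congr!
        · refine Finset.prod_congr rfl fun i _ => ?_
          rw [hq]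
          congr!
      rw [hmarg, ← div_div, ← hS, hsum]
      refine (mul_le_mul_of_nonneg_left hb h.le).trans (le_of_eq ?_)
      ring
    refine (Finset.sum_le_sum fun v _ => ?_).trans
      ((Finset.sum_le_sum fun v _ => step v).trans (le_of_eq ?_))
    · apply le_of_eq
      congr!
    rw [Finset.sum_add_distrib, Finset.sum_add_distrib, ← Finset.sum_mul, ← Finset.mul_sum,
      iid_sum_one hp1 n, m1, m2, hK]
    field_simp
    ring
  have hev : ∀ᶠ n : ℕ in atTop, (1 / (n : ℝ)) *
          (srcCbProb (fun v : Fin n → 𝒳 × 𝒵 => ∏ i, p (v i))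
              (fun v => Finset.prod_nonneg fun i _ => hp0 (v i))
              (iid_sum_one hp1 n)).condH
            (fun ω => fun i => (ω.1 i).1)
            (fun ω : (Fin n → 𝒳 × 𝒵) ×
                ((Fin n → 𝒳) → Fin (nLabels R_X n) × Fin (nLabels R_P n)) =>
              ((fun i => (ω.1 i).2), ω.2 (fun i => (ω.1 i).1), ω.2))
          ≤ Hc - R_X - R_P + δ := by
    obtain ⟨n0, hn0⟩ := exists_nat_ge (K / δ)
    filter_upwards [eventually_ge_atTop n0, eventually_gt_atTop 0] with n h1 h2
    have hn' : (0:ℝ) < n := by exact_mod_cast h2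
    have hKn : K ≤ n * δ := by
      rw [← div_le_iff₀ hδ]
      exact hn0.trans (by exact_mod_cast h1)
    rw [one_div, inv_mul_le_iff₀ hn']
    refine (hbound n h2).trans ?_
    linarith
  rw [Filter.limsup_eq]
  by_cases hbdd : BddBelow {a : ℝ | ∀ᶠ n : ℕ in atTop, (1 / (n : ℝ)) *
          (srcCbProb (fun v : Fin n → 𝒳 × 𝒵 => ∏ i, p (v i))
              (fun v => Finset.prod_nonneg fun i _ => hp0 (v i))
              (iid_sum_one hp1 n)).condH
            (fun ω => fun i => (ω.1 i).1)
            (fun ω : (Fin n → 𝒳 × 𝒵) ×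
                ((Fin n → 𝒳) → Fin (nLabels R_X n) × Fin (nLabels R_P n)) =>
              ((fun i => (ω.1 i).2), ω.2 (fun i => (ω.1 i).1), ω.2)) ≤ a}
  · exact csInf_le hbdd hev
  · rw [Real.sInf_of_not_bddBelow hbdd]
    linarith
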